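/- arXiv:1504.00168 — 2 statements merged into one kernel-verified Lean document; each statement's English description precedes it below -/
import Mathlib

section
/- Let $(M_i)_{i\ge 1}$ be a countable family of $R$-modules, $M = \bigoplus_{i=1}^{\infty} M_i$, $P = \prod_{i=1}^{\infty} M_i$, and $A = \bigcap_{n\ge 1}(M + \mathfrak m^n P)$. Then $A/M$ is radical, i.e. $\mathfrak m\cdot(A/M) = A/M$. -/
/- Throughout, `(R, 𝔪)` is a commutative noetherian local ring and all modules are `R`-modules.
`AdicCompletion (maximalIdeal R) M` is the `𝔪`-adic completion `lim M/𝔪^n M` and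
`IsHausdorff (maximalIdeal R) M` says that `M` is (`𝔪`-adically) separated. -/

open TensorProduct IsLocalRing

universe u

section Definitions

variable (R : Type u) [CommRing R]

/-- A linear map is a *pure monomorphism* if it is injective and remains injective after
tensoring with an arbitrary module. -/
def IsPureMono {M N : Type u} [AddCommGroup M] [Module R M] [AddCommGroup N] [Module R N]
    (f : M →ₗ[R] N) : Prop :=
  Function.Injective f ∧
    ∀ (X : Type u) [AddCommGroup X] [Module R X], Function.Injective (LinearMap.lTensor X f)

/-- A module `N` is *pure-injective* if every pure monomorphism out of `N` splits. -/
def IsPureInjective (N : Type u) [AddCommGroup N] [Module R N] : Prop :=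
  ∀ (Y : Type u) [AddCommGroup Y] [Module R Y] (f : N →ₗ[R] Y),
    IsPureMono R f → ∃ g : Y →ₗ[R] N, g ∘ₗ f = LinearMap.id

/-- A submodule `A ⊆ B` is *pure* if its inclusion is a pure monomorphism. -/
def IsPureSubmodule {B : Type u} [AddCommGroup B] [Module R B] (A : Submodule R B) : Prop :=
  IsPureMono R A.subtype

/-- An extension `A ⊆ B` is *pure-essential* if `A` is pure in `B` and for every submodule
`X ⊆ B` with `X ⊓ A = 0` such that `(X ⊕ A)/X` is pure in `B/X`, one has `X = 0`. -/
def IsPureEssential {B : Type u} [AddCommGroup B] [Module R B] (A : Submodule R B) : Prop :=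
  IsPureSubmodule R A ∧
    ∀ X : Submodule R B, X ⊓ A = ⊥ → IsPureMono R (X.mkQ ∘ₗ A.subtype) → X = ⊥

/-- An extension `A ⊆ B` is *strictly pure-essential* if it is pure-essential and for every
extension `B ⊆ Y` in which `A` is pure in `Y`, also `B` is pure in `Y`. -/
def IsStrictlyPureEssential {B : Type u} [AddCommGroup B] [Module R B] (A : Submodule R B) :
    Prop :=
  IsPureEssential R A ∧
    ∀ (Y : Type u) [AddCommGroup Y] [Module R Y] (g : B →ₗ[R] Y),
      Function.Injective g → IsPureMono R (g ∘ₗ A.subtype) → IsPureMono R g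

/-- A module `M` over a local ring is *totally separated* if `X ⊗[R] M` is `𝔪`-adically
separated for every finitely generated `R`-module `X`. -/
def IsTotallySeparatedModule [IsLocalRing R] (M : Type u) [AddCommGroup M] [Module R M] :
    Prop :=
  ∀ (X : Type u) [AddCommGroup X] [Module R X] [Module.Finite R X],
    IsHausdorff (maximalIdeal R) (X ⊗[R] M)

end Definitions

/-- An element of `I • N`, with `I` generated by a finset `s`, is a combination of the generators
with coefficients in `N`. -/
theorem exists_sum_smul_of_mem_span_smul {R M : Type*} [CommRing R] [AddCommGroup M] [Module R M]
    (s : Finset R) (N : Submodule R M) {x : M} (hx : x ∈ Ideal.span (s : Set R) • N) :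
    ∃ c : R → M, (∀ r, c r ∈ N) ∧ x = ∑ r ∈ s, r • c r := by
  induction hx using Submodule.smul_induction_on' with
  | smul r hr n hn =>
    obtain ⟨f, -, rfl⟩ := Submodule.mem_span_finset.1 hr
    refine ⟨fun t => f t • n, fun t => N.smul_mem _ hn, ?_⟩
    rw [Finset.sum_smul]
    refine Finset.sum_congr rfl fun t _ => ?_
    rw [smul_eq_mul, smul_smul, mul_comm]
  | add x _ y _ hx hy =>
    obtain ⟨c, hc, rfl⟩ := hx
    obtain ⟨d, hd, rfl⟩ := hy
    exact ⟨fun r => c r + d r, fun r => N.add_mem (hc r) (hd r), by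
      simp only [smul_add, Finset.sum_add_distrib]⟩

/-- For a finitely generated ideal `I`, membership in `I • ∏ M i` is checked componentwise. -/
theorem mem_smul_top_pi_iff {R ι : Type*} [CommRing R] {M : ι → Type*} [∀ i, AddCommGroup (M i)]
    [∀ i, Module R (M i)] {I : Ideal R} (hI : I.FG) {f : (i : ι) → M i} :
    f ∈ I • (⊤ : Submodule R ((i : ι) → M i)) ↔ ∀ i, f i ∈ I • (⊤ : Submodule R (M i)) := by
  constructor
  · intro hf i
    have h := Submodule.mem_map_of_mem (f := LinearMap.proj i) hf
    rw [Submodule.map_smul''] at h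
    exact Submodule.smul_mono le_rfl le_top h
  · intro hf
    obtain ⟨s, rfl⟩ := hI
    choose c _ hc using fun i => exists_sum_smul_of_mem_span_smul s ⊤ (hf i)
    have : f = ∑ r ∈ s, r • fun i => c i r := by
      ext i
      simp [← hc i]
    rw [this]
    exact Submodule.sum_mem _ fun r hr =>
      Submodule.smul_mem_smul (Submodule.subset_span hr) Submodule.mem_top

/-- Inside a countable product, the direct sum consists of the eventually vanishing families. -/
theorem mem_iSup_range_single_iff {R : Type*} [CommRing R] {M : ℕ → Type*}
    [∀ i, AddCommGroup (M i)] [∀ i, Module R (M i)] {f : (i : ℕ) → M i} :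
    f ∈ ⨆ i, LinearMap.range (LinearMap.single R M i) ↔ ∃ N, ∀ i, N ≤ i → f i = 0 := by
  constructor
  · intro hf
    induction hf using Submodule.iSup_induction' with
    | mem i x hx =>
      obtain ⟨y, rfl⟩ := hx
      refine ⟨i + 1, fun j hj => ?_⟩
      rw [LinearMap.single_apply]
      exact Pi.single_eq_of_ne (by omega) y
    | zero => exact ⟨0, fun _ _ => rfl⟩
    | add x y _ _ hx hy =>
      obtain ⟨a, ha⟩ := hx
      obtain ⟨b, hb⟩ := hy
      refine ⟨max a b, fun i hi => ?_⟩
      rw [Pi.add_apply, ha i (le_of_max_le_left hi), hb i (le_of_max_le_right hi), add_zero]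
  · rintro ⟨N, hN⟩
    have : f = ∑ i ∈ Finset.range N, LinearMap.single R M i (f i) := by
      ext j
      simp only [LinearMap.single_apply, Finset.sum_apply, Finset.sum_pi_single, Finset.mem_range]
      split_ifs with h
      · rfl
      · exact hN j (not_lt.1 h)
    rw [this]
    exact Submodule.sum_mem _ fun i _ => Submodule.mem_iSup_of_mem i ⟨f i, rfl⟩

/-- Membership in `⊕ M i + I ∏ M i`, for a finitely generated ideal `I`, means that almost all
components lie in `I M i`. -/
theorem mem_iSup_range_single_sup_smul_top_iff {R : Type*} [CommRing R] {M : ℕ → Type*}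
    [∀ i, AddCommGroup (M i)] [∀ i, Module R (M i)] {I : Ideal R} (hI : I.FG)
    {f : (i : ℕ) → M i} :
    f ∈ (⨆ i, LinearMap.range (LinearMap.single R M i)) ⊔ I • ⊤ ↔
      ∃ N, ∀ i, N ≤ i → f i ∈ I • (⊤ : Submodule R (M i)) := by
  rw [Submodule.mem_sup]
  constructor
  · rintro ⟨y, hy, z, hz, rfl⟩
    obtain ⟨N, hN⟩ := mem_iSup_range_single_iff.1 hy
    refine ⟨N, fun i hi => ?_⟩
    rw [Pi.add_apply, hN i hi, zero_add]
    exact (mem_smul_top_pi_iff hI).1 hz i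
  · rintro ⟨N, hN⟩
    refine ⟨fun i => if N ≤ i then 0 else f i,
      mem_iSup_range_single_iff.2 ⟨N, fun i hi => if_pos hi⟩,
      fun i => if N ≤ i then f i else 0, (mem_smul_top_pi_iff hI).2 fun i => ?_, ?_⟩
    · split_ifs with h
      · exact hN i h
      · exact Submodule.zero_mem _
    · ext i
      by_cases h : N ≤ i <;> simp [h]

/-- For a countable family `(M i)_{i : ℕ}` with `M = ⊕ M i ⊆ P = ∏ M i`
and `A = ⋂_{n ≥ 1} (M + 𝔪^n P)`, the quotient `A/M` is radical, i.e. `M + 𝔪 A = A`. -/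
theorem closure_quotient_radical_countable (R : Type u) [CommRing R] [IsNoetherianRing R]
    [IsLocalRing R] (M : ℕ → Type u)
    [∀ i, AddCommGroup (M i)] [∀ i, Module R (M i)]
    (Md A : Submodule R ((i : ℕ) → M i))
    (hMd : Md = ⨆ i, LinearMap.range (LinearMap.single R M i))
    (hA : A = ⨅ (n : ℕ) (_ : 1 ≤ n), (Md ⊔ maximalIdeal R ^ n • ⊤)) :
    Md ⊔ maximalIdeal R • A = A := by
  have mem_A : ∀ f : (i : ℕ) → M i, f ∈ A ↔
      ∀ n, 1 ≤ n → ∃ N, ∀ i, N ≤ i → f i ∈ maximalIdeal R ^ n • (⊤ : Submodule R (M i)) := by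
    intro f
    simp only [hA, hMd, Submodule.mem_iInf]
    exact forall₂_congr fun n _ =>
      mem_iSup_range_single_sup_smul_top_iff (IsNoetherian.noetherian _)
  refine le_antisymm (sup_le ?_ Submodule.smul_le_right) fun a ha => ?_
  · rw [hA]
    exact le_iInf₂ fun n _ => le_sup_left
  classical
  obtain ⟨s, hs⟩ : (maximalIdeal R).FG := IsNoetherian.noetherian _
  -- `k i` is the `𝔪`-adic order of `a i`, truncated at `i`; it tends to infinity.
  let k : ℕ → ℕ := fun i =>
    Nat.findGreatest (fun n => a i ∈ maximalIdeal R ^ n • (⊤ : Submodule R (M i))) i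
  have hk : ∀ i, a i ∈ maximalIdeal R ^ k i • (⊤ : Submodule R (M i)) := fun i =>
    Nat.findGreatest_spec (P := fun n => a i ∈ maximalIdeal R ^ n • (⊤ : Submodule R (M i)))
      (Nat.zero_le i) (by simp)
  have hk_tendsto : ∀ n, 1 ≤ n → ∃ N, ∀ i, N ≤ i → n ≤ k i := by
    intro n hn
    obtain ⟨N, hN⟩ := (mem_A a).1 ha n hn
    exact ⟨max n N, fun i hi =>
      Nat.le_findGreatest (le_of_max_le_left hi) (hN i (le_of_max_le_right hi))⟩
  have hdiv : ∀ i, ∃ c : R → M i,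
      (∀ r, c r ∈ maximalIdeal R ^ (k i - 1) • (⊤ : Submodule R (M i))) ∧
        (1 ≤ k i → a i = ∑ r ∈ s, r • c r) := by
    intro i
    by_cases h : 1 ≤ k i
    · have hi := hk i
      rw [← Nat.sub_add_cancel h, pow_succ', mul_smul, ← hs] at hi
      obtain ⟨c, hc, hac⟩ := exists_sum_smul_of_mem_span_smul s _ hi
      rw [hs] at hc
      exact ⟨c, hc, fun _ => hac⟩
    · exact ⟨0, fun _ => Submodule.zero_mem _, fun h' => absurd h' h⟩
  choose c hc hac using hdiv
  rw [← sub_add_cancel a (∑ r ∈ s, r • fun i => c i r)]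
  refine Submodule.add_mem_sup ?_ (Submodule.sum_mem _ fun r hr =>
    Submodule.smul_mem_smul (hs ▸ Submodule.subset_span hr) ((mem_A _).2 fun n _ => ?_))
  · rw [hMd, mem_iSup_range_single_iff]
    obtain ⟨N, hN⟩ := hk_tendsto 1 le_rfl
    refine ⟨N, fun i hi => ?_⟩
    simp [← hac i (hN i hi)]
  · obtain ⟨N, hN⟩ := hk_tendsto (n + 1) (by omega)
    exact ⟨N, fun i hi => Submodule.smul_mono_left
      (Ideal.pow_le_pow_right (by have := hN i hi; omega)) (hc i r)⟩
end

section
/- Let $(M_i)_{i\in I}$ be a family of $R$-modules, $M = \bigoplus_{i\in I} M_i$, $P = \prod_{i\in I} M_i$, $A = \bigcap_{n\ge 1}(M + \mathfrak m^n P)$. The following are equivalent: (i) $A/M$ is radical; (ii) $A \cap \mathfrak m P = \mathfrak m A$; (iii) $A \cap \mathfrak b P = \mathfrak b A$ for every open ideal $\mathfrak b$ of $R$; (iv) $H(A) = H(P)$. -/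
/- Throughout, `(R, 𝔪)` is a commutative noetherian local ring and all modules are `R`-modules.
`AdicCompletion (maximalIdeal R) M` is the `𝔪`-adic completion `lim M/𝔪^n M` and
`IsHausdorff (maximalIdeal R) M` says that `M` is (`𝔪`-adically) separated. -/

open TensorProduct IsLocalRing

universe u

section ProductModules

variable {R : Type*} [CommRing R]

theorem mem_span_range_smul_iff {N : Type*} [AddCommGroup N] [Module R N] {s : ℕ}
    (r : Fin s → R) (L : Submodule R N) (x : N) :
    x ∈ Ideal.span (Set.range r) • L ↔
      ∃ c : Fin s → N, (∀ k, c k ∈ L) ∧ ∑ k, r k • c k = x := by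
  constructor
  · intro hx
    refine Submodule.smul_induction_on hx ?_ ?_
    · intro t ht n hn
      obtain ⟨c, rfl⟩ := (Submodule.mem_span_range_iff_exists_fun R).1 ht
      refine ⟨fun k => c k • n, fun k => L.smul_mem _ hn, ?_⟩
      simp only [Finset.sum_smul, smul_smul, smul_eq_mul, mul_comm]
    · rintro _ _ ⟨c, hc, rfl⟩ ⟨d, hd, rfl⟩
      exact ⟨fun k => c k + d k, fun k => L.add_mem (hc k) (hd k), by
        simp only [smul_add, Finset.sum_add_distrib]⟩
  · rintro ⟨c, hc, rfl⟩
    exact Submodule.sum_mem _ fun k _ =>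
      Submodule.smul_mem_smul (Ideal.subset_span ⟨k, rfl⟩) (hc k)

variable {ι : Type*} {M : ι → Type*} [∀ i, AddCommGroup (M i)] [∀ i, Module R (M i)]

theorem mem_smul_top_pi_iff_s16 {b : Ideal R} (hb : b.FG) (x : (i : ι) → M i) :
    x ∈ b • (⊤ : Submodule R ((i : ι) → M i)) ↔
      ∀ i, x i ∈ b • (⊤ : Submodule R (M i)) := by
  constructor
  · intro hx i
    have h := Submodule.mem_map_of_mem (f := LinearMap.proj (R := R) (φ := M) i) hx
    rw [Submodule.map_smul''] at h
    exact Submodule.smul_mono le_rfl le_top h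
  · intro hx
    obtain ⟨s, r, rfl⟩ := Submodule.fg_iff_exists_fin_generating_family.1 hb
    choose c _ hc using fun i => (mem_span_range_smul_iff r _ _).1 (hx i)
    refine (mem_span_range_smul_iff r _ _).2 ⟨fun k i => c i k, fun _ => trivial, ?_⟩
    ext i
    simpa using hc i

variable [DecidableEq ι]

theorem mem_iSup_range_single_iff_s16 (x : (i : ι) → M i) :
    x ∈ (⨆ i, LinearMap.range (LinearMap.single R M i)) ↔ {i | x i ≠ 0}.Finite := by
  constructor
  · intro hx
    induction hx using Submodule.iSup_induction' with
    | mem i x hx =>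
      obtain ⟨y, rfl⟩ := hx
      refine (Set.finite_singleton i).subset fun j hj => ?_
      by_contra h
      exact hj (Pi.single_eq_of_ne h y)
    | zero => simp
    | add x y _ _ hx hy =>
      refine (hx.union hy).subset fun j hj => ?_
      by_contra h
      simp only [Set.mem_union, Set.mem_ofPred_eq, not_or, not_not] at h
      exact hj (by simp [h.1, h.2])
  · intro hx
    have h : x = ∑ i ∈ hx.toFinset, LinearMap.single R M i (x i) := by
      ext j
      simp only [Finset.sum_apply, LinearMap.single_apply]
      by_cases hj : x j = 0
      · rw [Finset.sum_eq_zero, hj]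
        intro i _
        by_cases hij : j = i
        · subst hij; simp [hj]
        · exact Pi.single_eq_of_ne hij _
      · rw [Finset.sum_eq_single j]
        · simp
        · intro i _ hij
          exact Pi.single_eq_of_ne hij.symm _
        · intro h; exact absurd (hx.mem_toFinset.2 hj) h
    rw [h]
    exact Submodule.sum_mem _ fun i _ => Submodule.mem_iSup_of_mem i ⟨_, rfl⟩

theorem iSup_range_single_inf_smul_top_le {b : Ideal R} (hb : b.FG) :
    (⨆ i, LinearMap.range (LinearMap.single R M i)) ⊓ b • ⊤ ≤
      b • ⨆ i, LinearMap.range (LinearMap.single R M i) := by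
  rintro x ⟨hx, hxb⟩
  obtain ⟨s, r, rfl⟩ := Submodule.fg_iff_exists_fin_generating_family.1 hb
  have hx' := (mem_iSup_range_single_iff_s16 (R := R) x).1 hx
  choose c _ hc using fun i =>
    (mem_span_range_smul_iff r _ _).1 ((mem_smul_top_pi_iff_s16 hb x).1 hxb i)
  classical
  refine (mem_span_range_smul_iff r _ _).2
    ⟨fun k i => if x i = 0 then 0 else c i k, fun k => ?_, ?_⟩
  · refine (mem_iSup_range_single_iff_s16 _).2 (hx'.subset fun i hi h => hi ?_)
    simp [h]
  · ext i
    by_cases h : x i = 0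
    · simp [h]
    · simpa [h] using hc i

theorem mem_iSup_range_single_sup_smul_top_iff_s16 {b : Ideal R} (hb : b.FG) (x : (i : ι) → M i) :
    x ∈ (⨆ i, LinearMap.range (LinearMap.single R M i)) ⊔ b • ⊤ ↔
      {i | x i ∉ b • (⊤ : Submodule R (M i))}.Finite := by
  constructor
  · intro hx
    obtain ⟨y, hy, z, hz, rfl⟩ := Submodule.mem_sup.1 hx
    refine ((mem_iSup_range_single_iff_s16 y).1 hy).subset fun i hi h => hi ?_
    simpa [h] using (mem_smul_top_pi_iff_s16 hb z).1 hz i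
  · intro hx
    classical
    refine Submodule.mem_sup.2
      ⟨fun i => if x i ∈ b • (⊤ : Submodule R (M i)) then 0 else x i, ?_,
       fun i => if x i ∈ b • (⊤ : Submodule R (M i)) then x i else 0, ?_, ?_⟩
    · refine (mem_iSup_range_single_iff_s16 _).2 (hx.subset fun i hi h => hi ?_)
      simp [h]
    · refine (mem_smul_top_pi_iff_s16 hb _).2 fun i => ?_
      show (if x i ∈ b • (⊤ : Submodule R (M i)) then x i else 0) ∈ _
      split_ifs with h
      · exact h
      · exact Submodule.zero_mem _
    · ext i
      by_cases h : x i ∈ b • (⊤ : Submodule R (M i)) <;> simp [h]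

end ProductModules

/-- An element of `I N` outside `⋂ Iⁿ N` can be written in terms of the generators of `I` with
coefficients whose `I`-adic order drops by at most one. -/
theorem exists_sum_smul_eq_of_notMem_pow {R : Type*} [CommRing R] {N : Type*} [AddCommGroup N]
    [Module R N] {s : ℕ} (r : Fin s → R) {I : Ideal R} (hI : Ideal.span (Set.range r) = I) {x : N}
    (hx : x ∈ I • (⊤ : Submodule R N)) (hx' : ∃ n, x ∉ I ^ n • (⊤ : Submodule R N)) :
    ∃ c : Fin s → N, ∑ k, r k • c k = x ∧
      ∀ n, x ∈ I ^ (n + 1) • (⊤ : Submodule R N) → ∀ k, c k ∈ I ^ n • (⊤ : Submodule R N) := by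
  classical
  have hmono : ∀ {a b : ℕ}, a ≤ b → I ^ b • (⊤ : Submodule R N) ≤ I ^ a • ⊤ := fun h =>
    Submodule.smul_mono_left (Ideal.pow_le_pow_right h)
  obtain ⟨n, hn⟩ : ∃ n, Nat.find hx' = n + 2 := by
    refine ⟨Nat.find hx' - 2, ?_⟩
    have : 2 ≤ Nat.find hx' := by
      refine (Nat.le_find_iff hx' 2).2 fun m hm h => h ?_
      exact hmono (Nat.le_of_lt_succ hm) (by simpa using hx)
    omega
  have hmem : x ∈ I ^ (n + 1) • (⊤ : Submodule R N) :=
    not_not.1 (Nat.find_min hx' (m := n + 1) (by omega))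
  have hnot : x ∉ I ^ (n + 2) • (⊤ : Submodule R N) := hn ▸ Nat.find_spec hx'
  rw [pow_succ', Submodule.mul_smul, ← hI, mem_span_range_smul_iff, hI] at hmem
  obtain ⟨c, hc, hsum⟩ := hmem
  refine ⟨c, hsum, fun m hm k => hmono ?_ (hc k)⟩
  by_contra h
  exact hnot (hmono (by omega) hm)

/-- With `M = ⊕ M i ⊆ P = ∏ M i` and `A = ⋂_{n ≥ 1} (M + 𝔪^n P)`, the
following are equivalent: (i) `A/M` is radical, i.e. `M + 𝔪 A = A`; (ii) `A ∩ 𝔪 P = 𝔪 A`;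
(iii) `A ∩ 𝔟 P = 𝔟 A` for every open ideal `𝔟`; (iv) `H(A) = H(P)`. -/
theorem closure_radical_tfae (R : Type u) [CommRing R] [IsNoetherianRing R] [IsLocalRing R]
    {ι : Type u} [DecidableEq ι] (M : ι → Type u)
    [∀ i, AddCommGroup (M i)] [∀ i, Module R (M i)]
    (Md A : Submodule R ((i : ι) → M i))
    (hMd : Md = ⨆ i, LinearMap.range (LinearMap.single R M i))
    (hA : A = ⨅ (n : ℕ) (_ : 1 ≤ n), (Md ⊔ maximalIdeal R ^ n • ⊤)) :
    List.TFAE [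
      Md ⊔ maximalIdeal R • A = A,
      A ⊓ maximalIdeal R • (⊤ : Submodule R ((i : ι) → M i)) = maximalIdeal R • A,
      ∀ b : Ideal R, (∃ e : ℕ, 1 ≤ e ∧ maximalIdeal R ^ e ≤ b) →
        A ⊓ b • (⊤ : Submodule R ((i : ι) → M i)) = b • A,
      (⨅ (n : ℕ) (_ : 1 ≤ n), maximalIdeal R ^ n • A) =
        ⨅ (n : ℕ) (_ : 1 ≤ n),
          maximalIdeal R ^ n • (⊤ : Submodule R ((i : ι) → M i))] := by
  set m := maximalIdeal R with hm
  have hfg : ∀ b : Ideal R, b.FG := fun b => IsNoetherian.noetherian b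
  have hMA : Md ≤ A := hA ▸ le_iInf₂ fun n _ => le_sup_left
  have hmemA : ∀ x, x ∈ A ↔ ∀ n, {i | x i ∉ m ^ n • (⊤ : Submodule R (M i))}.Finite := by
    intro x
    simp only [hA, hMd, Submodule.mem_iInf,
      mem_iSup_range_single_sup_smul_top_iff_s16 (hfg _)]
    refine ⟨fun h n => ?_, fun h n _ => h n⟩
    rcases n with _ | n
    · simp
    · exact h (n + 1) (by omega)
  have hHA : (⨅ (n : ℕ) (_ : 1 ≤ n), m ^ n • (⊤ : Submodule R ((i : ι) → M i))) ≤ A :=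
    hA ▸ iInf₂_mono fun n _ => le_sup_right
  tfae_have 3 → 2 := fun h => h m ⟨1, le_rfl, by simp⟩
  tfae_have 2 → 1 := by
    intro h
    have hle : A ≤ Md ⊔ m • ⊤ := by
      rw [hA]
      exact (iInf₂_le 1 le_rfl).trans (by simp)
    rw [← h, inf_comm, ← sup_inf_assoc_of_le _ hMA]
    exact inf_eq_right.2 hle
  tfae_have 1 → 3 := by
    rintro h b ⟨e, -, he⟩
    have hpow : ∀ n, A ≤ Md ⊔ m ^ n • A := by
      intro n
      induction n with
      | zero => simp
      | succ n ih =>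
        refine ih.trans (sup_le le_sup_left ?_)
        calc m ^ n • A = m ^ n • Md ⊔ m ^ n • m • A := by rw [← Submodule.smul_sup, h]
          _ ≤ Md ⊔ m ^ (n + 1) • A := by
            rw [pow_succ, Submodule.mul_smul]
            exact sup_le_sup_right Submodule.smul_le_right _
    have hmb : m ^ e • A ≤ b • A := Submodule.smul_mono_left he
    refine le_antisymm ?_ (le_inf Submodule.smul_le_right (Submodule.smul_mono le_rfl le_top))
    rintro x ⟨hxA, hxb⟩
    obtain ⟨y, hy, z, hz, rfl⟩ := Submodule.mem_sup.1 (hpow e hxA)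
    have hzb := hmb hz
    have hyb : y ∈ b • (⊤ : Submodule R ((i : ι) → M i)) :=
      (Submodule.add_mem_iff_left _ (Submodule.smul_mono le_rfl le_top hzb)).1 hxb
    refine Submodule.add_mem _ (Submodule.smul_mono le_rfl hMA ?_) hzb
    subst hMd
    exact iSup_range_single_inf_smul_top_le (hfg b) ⟨hy, hyb⟩
  tfae_have 3 → 4 := by
    intro h
    refine le_antisymm (iInf₂_mono fun n _ => Submodule.smul_mono le_rfl le_top)
      (le_iInf₂ fun n hn => ?_)
    rw [← h (m ^ n) ⟨n, hn, le_rfl⟩]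
    exact le_inf hHA (iInf₂_le n hn)
  tfae_have 4 → 1 := by
    intro h
    refine le_antisymm (sup_le hMA Submodule.smul_le_right) fun a ha => ?_
    obtain ⟨s, r, hr⟩ := Submodule.fg_iff_exists_fin_generating_family.1 (hfg m)
    have hHm : (⨅ (n : ℕ) (_ : 1 ≤ n), m ^ n • (⊤ : Submodule R ((i : ι) → M i))) ≤ m • A := by
      rw [← h]
      exact (iInf₂_le 1 le_rfl).trans (by simp)
    have hfin := (hmemA a).1 ha
    have hex : ∀ i, ∃ c : Fin s → M i,
        (a i ∈ m • (⊤ : Submodule R (M i)) → (∃ n, a i ∉ m ^ n • (⊤ : Submodule R (M i))) →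
          ∑ k, r k • c k = a i) ∧
        ((∀ n, a i ∈ m ^ n • (⊤ : Submodule R (M i))) → c = 0) ∧
        ∀ n, a i ∈ m ^ (n + 1) • (⊤ : Submodule R (M i)) →
          ∀ k, c k ∈ m ^ n • (⊤ : Submodule R (M i)) := by
      intro i
      by_cases h₁ : a i ∈ m • (⊤ : Submodule R (M i)) ∧
          ∃ n, a i ∉ m ^ n • (⊤ : Submodule R (M i))
      · obtain ⟨c, hc, hc'⟩ := exists_sum_smul_eq_of_notMem_pow r hr h₁.1 h₁.2
        exact ⟨c, fun _ _ => hc, fun h => absurd h (not_forall.2 h₁.2), hc'⟩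
      · exact ⟨0, fun h h' => absurd ⟨h, h'⟩ h₁, fun _ => rfl, fun _ _ _ => Submodule.zero_mem _⟩
    choose c hsum hzero hc using hex
    have hcA : ∀ k, (fun i => c i k) ∈ A := fun k =>
      (hmemA _).2 fun n => (hfin (n + 1)).subset fun i hi h' => hi (hc i n h' k)
    have hcm : ∑ k, r k • (fun i => c i k) ∈ m • A :=
      hr ▸ (mem_span_range_smul_iff r A _).2 ⟨_, hcA, rfl⟩
    -- The remainder lies in `⋂ 𝔪ⁿ P` up to the finitely many coordinates outside `𝔪 M i`.
    have hrem : a - ∑ k, r k • (fun i => c i k) ∈ Md ⊔ m • A := by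
      classical
      refine Submodule.mem_sup.2
        ⟨fun i => if a i ∈ m • (⊤ : Submodule R (M i)) then 0
            else (a - ∑ k, r k • (fun i => c i k) : (i : ι) → M i) i, ?_,
          fun i => if a i ∈ m • (⊤ : Submodule R (M i))
            then (a - ∑ k, r k • (fun i => c i k) : (i : ι) → M i) i else 0, hHm ?_, ?_⟩
      · rw [hMd, mem_iSup_range_single_iff_s16]
        refine (hfin 1).subset fun i hi h' => hi ?_
        rw [pow_one] at h'
        simp only [h', if_true]
      · simp only [Submodule.mem_iInf, mem_smul_top_pi_iff_s16 (hfg _)]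
        intro n _ i
        split_ifs with hi
        · by_cases hi' : ∃ n, a i ∉ m ^ n • (⊤ : Submodule R (M i))
          · simp [hsum i hi hi']
          · push Not at hi'
            simpa [hzero i hi'] using hi' n
        · exact Submodule.zero_mem _
      · ext i
        by_cases hi : a i ∈ m • (⊤ : Submodule R (M i)) <;> simp [hi]
    simpa using Submodule.add_mem _ hrem (Submodule.mem_sup_right hcm)
  tfae_finish
end
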